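/- arXiv:1510.04571 — 6 statements merged into one kernel-verified Lean document; each statement's English description precedes it below -/
import Mathlib

section
/- Let S be a nonempty set, let u, v : S → ℝ with v(x) > 0 for every x ∈ S, let C ≥ 1 be a real constant, and let m, M be real numbers with m·v(x) ≤ u(x) ≤ M·v(x) for all x ∈ S. Assume the two Harnack-type comparisons: for all x, y ∈ S, (u(x) − m·v(x))·v(y) ≤ C·(u(y) − m·v(y))·v(x), and (M·v(x) − u(x))·v(y) ≤ C·(M·v(y) − u(y))·v(x). Then (C+1)·( sup_{x∈S} u(x)/v(x) − inf_{x∈S} u(x)/v(x) ) ≤ (C−1)·(M − m). -/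
/-- Oscillation-reduction inequality underlying Lemmas 2.2 and 2.7:
from the two Harnack-type comparisons one deduces
`(C+1)·(sup u/v − inf u/v) ≤ (C−1)·(M − m)`. -/
theorem oscillation_reduction
    {S : Type*} [Nonempty S] (u v : S → ℝ) (hv : ∀ x, 0 < v x)
    (C : ℝ) (hC : 1 ≤ C) (m M : ℝ)
    (hm : ∀ x, m * v x ≤ u x) (hM : ∀ x, u x ≤ M * v x)
    (h1 : ∀ x y, (u x - m * v x) * v y ≤ C * (u y - m * v y) * v x)
    (h2 : ∀ x y, (M * v x - u x) * v y ≤ C * (M * v y - u y) * v x) :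
    (C + 1) * ((⨆ x, u x / v x) - ⨅ x, u x / v x) ≤ (C - 1) * (M - m) := by
  have hC0 : 0 < C := by linarith
  have hu : ∀ x, u x = u x / v x * v x := fun x => (div_mul_cancel₀ _ (hv x).ne').symm
  set f : S → ℝ := fun x => u x / v x with hf
  have lower : ∀ x y, f x - m ≤ C * (f y - m) := by
    intro x y
    have h := h1 x y
    rw [hu x, hu y] at h
    refine le_of_mul_le_mul_right ?_ (mul_pos (hv x) (hv y))
    simp only [hf]
    linarith
  have upper : ∀ x y, M - f y ≤ C * (M - f x) := by
    intro x y
    have h := h2 y x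
    rw [hu x, hu y] at h
    refine le_of_mul_le_mul_right ?_ (mul_pos (hv x) (hv y))
    simp only [hf]
    linarith
  have sup_inf_lower : (⨆ x, f x) - m ≤ C * ((⨅ x, f x) - m) := by
    have h : ((⨆ x, f x) - m) / C + m ≤ ⨅ x, f x := by
      refine le_ciInf fun y => ?_
      have hs : (⨆ x, f x) ≤ C * (f y - m) + m :=
        ciSup_le fun x => by linarith [lower x y]
      have : ((⨆ x, f x) - m) / C ≤ f y - m := by
        rw [div_le_iff₀' hC0]
        linarith
      linarith
    rw [← div_le_iff₀' hC0]
    linarith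
  have sup_inf_upper : M - (⨅ x, f x) ≤ C * (M - ⨆ x, f x) := by
    have h : M - C * (M - ⨆ x, f x) ≤ ⨅ x, f x := by
      refine le_ciInf fun y => ?_
      have hs : (⨆ x, f x) ≤ M - (M - f y) / C := by
        refine ciSup_le fun x => ?_
        have : (M - f y) / C ≤ M - f x := by
          rw [div_le_iff₀' hC0]
          exact upper x y
        linarith
      have : M - f y ≤ C * (M - ⨆ x, f x) := by
        rw [← div_le_iff₀' hC0]
        linarith
      linarith
    linarith
  linarith
end

section
/- Let S be a nonempty set, let K ≥ 0 and C ≥ 1 be real constants, and let f1, f2, g1, g2 : S → ℝ satisfy f1(x) > 0, f2(x) > 0, 0 ≤ g1(x) ≤ K·f1(x) and 0 ≤ g2(x) ≤ K·f2(x) for all x ∈ S. Assume the set { f1(x)/f2(x) : x ∈ S } is bounded above, and let mq, Mq be reals with 0 < mq ≤ Mq and mq ≤ (f1(x)+g1(x))/(f2(x)+g2(x)) for all x ∈ S. If (C+1)·( sup_{x∈S} f1(x)/f2(x) − inf_{x∈S} f1(x)/f2(x) ) ≤ (C−1)·(Mq − mq), then sup_{x∈S} (f1(x)+g1(x))/(f2(x)+g2(x))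 divided by inf_{x∈S} (f1(x)+g1(x))/(f2(x)+g2(x)) is at most (1+K)² + (1+K)·((C−1)/(C+1))·(Mq/mq − 1). -/
/-- Perturbing numerator and denominator of a ratio by relative amounts in `[0, K]` changes the
ratio by a factor of at most `1 + K` upwards. -/
lemma perturbed_ratio_le {K a b c d : ℝ} (ha : 0 < a) (hb : 0 < b) (hK : 0 ≤ K)
    (hc : c ≤ K * a) (hd : 0 ≤ d) : (a + c) / (b + d) ≤ (1 + K) * (a / b) := by
  rw [← mul_div_assoc]
  exact div_le_div₀ (by positivity) (by linarith) hb (by linarith)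

/-- Perturbing numerator and denominator of a ratio by relative amounts in `[0, K]` changes the
ratio by a factor of at most `1 + K` downwards. -/
lemma ratio_le_perturbed {K a b c d : ℝ} (ha : 0 < a) (hb : 0 < b)
    (hc : 0 ≤ c) (hd : 0 ≤ d) (hd' : d ≤ K * b) : a / b ≤ (1 + K) * ((a + c) / (b + d)) := by
  have hbd : 0 < b + d := by linarith
  rw [← mul_div_assoc, div_le_div_iff₀ hb hbd]
  calc a * (b + d) ≤ (a + c) * ((1 + K) * b) := by gcongr <;> linarith
    _ = (1 + K) * (a + c) * b := by ring

/-- Arithmetic core of Lemmas 2.4 and 2.9: bound on the relative oscillation of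
`(f1+g1)/(f2+g2)` in terms of the oscillation of `f1/f2` and the perturbation size `K`. -/
theorem relative_oscillation_bound
    {S : Type*} [Nonempty S] (K C : ℝ) (hK : 0 ≤ K) (hC : 1 ≤ C)
    (f1 f2 g1 g2 : S → ℝ)
    (hf1 : ∀ x, 0 < f1 x) (hf2 : ∀ x, 0 < f2 x)
    (hg1 : ∀ x, 0 ≤ g1 x ∧ g1 x ≤ K * f1 x)
    (hg2 : ∀ x, 0 ≤ g2 x ∧ g2 x ≤ K * f2 x)
    (hbdd : BddAbove (Set.range fun x => f1 x / f2 x))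
    (mq Mq : ℝ) (hmq : 0 < mq) (hmqMq : mq ≤ Mq)
    (hlow : ∀ x, mq ≤ (f1 x + g1 x) / (f2 x + g2 x))
    (hosc : (C + 1) * ((⨆ x, f1 x / f2 x) - ⨅ x, f1 x / f2 x) ≤ (C - 1) * (Mq - mq)) :
    (⨆ x, (f1 x + g1 x) / (f2 x + g2 x)) / (⨅ x, (f1 x + g1 x) / (f2 x + g2 x)) ≤
      (1 + K) ^ 2 + (1 + K) * ((C - 1) / (C + 1)) * (Mq / mq - 1) := by
  have hr_below : BddBelow (Set.range fun x => f1 x / f2 x) :=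
    ⟨0, by rintro _ ⟨x, rfl⟩; exact (div_pos (hf1 x) (hf2 x)).le⟩
  have hinf : mq ≤ ⨅ x, (f1 x + g1 x) / (f2 x + g2 x) := le_ciInf hlow
  have hsup : (⨆ x, (f1 x + g1 x) / (f2 x + g2 x)) ≤ (1 + K) * ⨆ x, f1 x / f2 x := by
    refine ciSup_le fun x => ?_
    refine (perturbed_ratio_le (hf1 x) (hf2 x) hK (hg1 x).2 (hg2 x).1).trans ?_
    exact mul_le_mul_of_nonneg_left (le_ciSup hbdd x) (by linarith)
  have hinf' : (⨅ x, f1 x / f2 x) ≤ (1 + K) * ⨅ x, (f1 x + g1 x) / (f2 x + g2 x) := by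
    rw [← div_le_iff₀' (by linarith)]
    refine le_ciInf fun x => ?_
    rw [div_le_iff₀' (by linarith)]
    exact (ciInf_le hr_below x).trans
      (ratio_le_perturbed (hf1 x) (hf2 x) (hg1 x).1 (hg2 x).1 (hg2 x).2)
  have hosc' : (⨆ x, f1 x / f2 x) - (⨅ x, f1 x / f2 x) ≤ (C - 1) / (C + 1) * (Mq - mq) := by
    rw [div_mul_eq_mul_div, le_div_iff₀' (by linarith)]
    exact hosc
  generalize (⨆ x, (f1 x + g1 x) / (f2 x + g2 x)) = s at *
  generalize (⨅ x, (f1 x + g1 x) / (f2 x + g2 x)) = i at *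
  generalize (⨆ x, f1 x / f2 x) = M at *
  generalize (⨅ x, f1 x / f2 x) = m at *
  have hratio : 0 ≤ (C - 1) / (C + 1) := div_nonneg (by linarith) (by linarith)
  have hquot : 0 ≤ Mq / mq - 1 := by
    rw [sub_nonneg, one_le_div hmq]
    exact hmqMq
  have hdiff : Mq - mq = (Mq / mq - 1) * mq := by field_simp
  rw [div_le_iff₀ (hmq.trans_le hinf)]
  calc s ≤ (1 + K) * M := hsup
    _ ≤ (1 + K) * ((1 + K) * i + (C - 1) / (C + 1) * ((Mq / mq - 1) * i)) := by
      refine mul_le_mul_of_nonneg_left ?_ (by linarith)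
      have := mul_le_mul_of_nonneg_left (mul_le_mul_of_nonneg_left hinf hquot) hratio
      rw [hdiff] at hosc'
      linarith
    _ = _ := by ring
end

section
/- Let d ≥ 1 be an integer, let β ≥ 0, 0 < δ4 < 1 and a4 > 0 be reals with β·(d − 1 + 2·δ4) ≤ 1, and let Ψ0 : (0,∞) → (0,∞) be a Borel measurable function satisfying Ψ0(t) ≤ a4·(t/s)^{2·δ4}·Ψ0(s) for all 0 < s ≤ t ≤ 1. Then for every T > 1, the Lebesgue integral ∫_T^∞ ( Ψ0(t^{−1}) / Ψ0(f(t)^{−1}) ) · f(t)^{d−1} · t^{−d} dt equals +∞, where f(t) = t·(log t)^{−β}. -/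
open Filter MeasureTheory Set in
/-- The function `t ↦ c * (t⁻¹ / log t)` has infinite lower Lebesgue integral at infinity. -/
theorem lintegral_Ioi_inv_div_log_eq_top {c M : ℝ} (hc : 0 < c) (hM : 1 ≤ M) :
    ∫⁻ t in Ioi M, ENNReal.ofReal (c * (t⁻¹ / Real.log t)) = ⊤ := by
  have hnot : ¬ IntegrableOn (fun t : ℝ => c * (t⁻¹ / Real.log t)) (Ioi M) := by
    refine not_integrableOn_of_tendsto_norm_atTop_of_deriv_isBigO_filter
      (f := fun t => Real.log (Real.log t)) atTop (Ioi_mem_atTop M) ?_ ?_ ?_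
    · filter_upwards [Ioi_mem_atTop (1 : ℝ)] with x hx
      exact Real.differentiableOn_log_log.differentiableAt (Ioi_mem_nhds hx)
    · exact tendsto_norm_atTop_atTop.comp
        (Real.tendsto_log_atTop.comp Real.tendsto_log_atTop)
    · rw [Real.deriv_log_log]
      exact Asymptotics.isBigO_self_const_mul hc.ne' _ _
  by_contra hfin
  have hmeas : Measurable fun t : ℝ => c * (t⁻¹ / Real.log t) :=
    (measurable_inv.div Real.measurable_log).const_mul c
  refine hnot ⟨hmeas.aestronglyMeasurable, ?_⟩
  rw [hasFiniteIntegral_iff_ofReal]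
  · exact lt_top_iff_ne_top.2 hfin
  · filter_upwards [ae_restrict_mem measurableSet_Ioi] with t ht
    have h1 : 1 < t := hM.trans_lt ht
    have := Real.log_pos h1
    show 0 ≤ c * (t⁻¹ / Real.log t)
    positivity

/-- Pointwise lower bound for the accessibility integrand of the thorn `t * (log t) ^ (-β)`. -/
theorem inv_div_log_le_thorn_integrand {n β δ a : ℝ} (hβ : 0 ≤ β) (ha : 0 < a)
    (hβδ : β * (n - 1 + 2 * δ) ≤ 1) {Ψ : ℝ → ℝ} (hpos : ∀ t : ℝ, 0 < t → 0 < Ψ t)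
    (hscale : ∀ s t : ℝ, 0 < s → s ≤ t → t ≤ 1 → Ψ t ≤ a * (t / s) ^ (2 * δ) * Ψ s)
    {t : ℝ} (ht : 0 < t) (hlog : 1 ≤ Real.log t) (hle : Real.log t ^ β ≤ t) :
    a⁻¹ * (t⁻¹ / Real.log t) ≤
      Ψ t⁻¹ / Ψ (t * Real.log t ^ (-β))⁻¹ * (t * Real.log t ^ (-β)) ^ (n - 1) * t ^ (-n) := by
  set L := Real.log t
  have hL : 0 < L := by linarith
  have hLβ : 0 < L ^ β := Real.rpow_pos_of_pos hL _
  have hLβ1 : 1 ≤ L ^ β := Real.one_le_rpow hlog hβ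
  have hfinv : (t * L ^ (-β))⁻¹ = L ^ β * t⁻¹ := by
    rw [Real.rpow_neg hL.le]; field_simp
  have hquot : L ^ β * t⁻¹ / t⁻¹ = L ^ β := by field_simp
  have hti : 0 < t⁻¹ := inv_pos.2 ht
  have hΨ : Ψ (L ^ β * t⁻¹) ≤ a * L ^ (β * (2 * δ)) * Ψ t⁻¹ := by
    have h := hscale t⁻¹ (L ^ β * t⁻¹) hti (le_mul_of_one_le_left hti.le hLβ1)
      (by rw [← div_eq_mul_inv]; exact (div_le_one ht).2 hle)
    rwa [hquot, ← Real.rpow_mul hL.le] at h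
  have hratio : a⁻¹ * L ^ (-(β * (2 * δ))) ≤ Ψ t⁻¹ / Ψ (L ^ β * t⁻¹) := by
    have hp : 0 < L ^ (β * (2 * δ)) := Real.rpow_pos_of_pos hL _
    rw [le_div_iff₀ (hpos _ (by positivity)), Real.rpow_neg hL.le, ← mul_inv,
      inv_mul_le_iff₀ (by positivity)]
    exact hΨ
  have hpow : (t * L ^ (-β)) ^ (n - 1) * t ^ (-n) = t⁻¹ * L ^ (-β * (n - 1)) := by
    rw [Real.mul_rpow ht.le (by positivity), ← Real.rpow_mul hL.le, mul_right_comm,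
      ← Real.rpow_add ht, ← Real.rpow_neg_one t]
    ring_nf
  have hexp : L⁻¹ ≤ L ^ (-(β * (2 * δ))) * L ^ (-β * (n - 1)) := by
    rw [← Real.rpow_add hL, ← Real.rpow_neg_one L]
    exact Real.rpow_le_rpow_of_exponent_le hlog (by linarith)
  rw [hfinv, mul_assoc, hpow]
  calc a⁻¹ * (t⁻¹ / L) = a⁻¹ * t⁻¹ * L⁻¹ := by ring
    _ ≤ a⁻¹ * t⁻¹ * (L ^ (-(β * (2 * δ))) * L ^ (-β * (n - 1))) := by gcongr
    _ = a⁻¹ * L ^ (-(β * (2 * δ))) * (t⁻¹ * L ^ (-β * (n - 1))) := by ring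
    _ ≤ _ := by gcongr

/-- Divergence of the accessibility integral for the thorn
`f(t) = t·(log t)^{−β}` when `β·(d−1+2δ4) ≤ 1`, under the upper weak scaling
condition at zero for `Ψ0` (hypothesis H2). -/
theorem thorn_integral_infinite
    (d : ℕ) (hd : 1 ≤ d) (β δ4 a4 : ℝ) (hβ : 0 ≤ β)
    (hδ4 : 0 < δ4) (hδ4' : δ4 < 1) (ha4 : 0 < a4)
    (hβδ : β * ((d : ℝ) - 1 + 2 * δ4) ≤ 1)
    (Ψ0 : ℝ → ℝ) (hΨ0meas : Measurable Ψ0) (hΨ0pos : ∀ t : ℝ, 0 < t → 0 < Ψ0 t)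
    (hscale : ∀ s t : ℝ, 0 < s → s ≤ t → t ≤ 1 → Ψ0 t ≤ a4 * (t / s) ^ (2 * δ4) * Ψ0 s)
    (T : ℝ) (hT : 1 < T) :
    ∫⁻ t in Set.Ioi T,
        ENNReal.ofReal
          (Ψ0 t⁻¹ / Ψ0 (t * Real.log t ^ (-β))⁻¹ *
            (t * Real.log t ^ (-β)) ^ ((d : ℝ) - 1) * t ^ (-(d : ℝ))) = ⊤ := by
  have hlarge : ∀ᶠ t : ℝ in Filter.atTop, 1 ≤ Real.log t ∧ Real.log t ^ β ≤ t := by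
    have hlittle := (isLittleO_log_rpow_rpow_atTop β one_pos).bound one_pos
    filter_upwards [hlittle, Filter.eventually_gt_atTop 0,
      Real.tendsto_log_atTop.eventually_ge_atTop 1] with t h ht hlog
    refine ⟨hlog, ?_⟩
    rw [Real.rpow_one, one_mul, Real.norm_of_nonneg ht.le] at h
    exact (le_abs_self _).trans h
  obtain ⟨M, hM⟩ := Filter.eventually_atTop.1 hlarge
  have hTN : T ≤ max T M := le_max_left _ _
  rw [eq_top_iff, ← lintegral_Ioi_inv_div_log_eq_top (inv_pos.2 ha4) (hT.le.trans hTN)]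
  refine le_trans ?_ (MeasureTheory.lintegral_mono_set (Set.Ioi_subset_Ioi hTN))
  refine MeasureTheory.setLIntegral_mono' measurableSet_Ioi fun t ht => ?_
  rw [Set.mem_Ioi, max_lt_iff] at ht
  obtain ⟨hlog, hle⟩ := hM t ht.2.le
  exact ENNReal.ofReal_le_ofReal
    (inv_div_log_le_thorn_integrand hβ ha4 hβδ hΨ0pos hscale (by linarith) hlog hle)
end

section
/- Let d ≥ 1 be an integer, let β ≥ 0, 0 < δ3 < 1 and a3 > 0 be reals with β·(d − 1 + 2·δ3) > 1, and let Ψ0 : (0,∞) → (0,∞) be a Borel measurable function satisfying a3·(t/s)^{2·δ3}·Ψ0(s) ≤ Ψ0(t) for all 0 < s ≤ t ≤ 1. Then there exists T > 1 such that the Lebesgue integral ∫_T^∞ ( Ψ0(t^{−1}) / Ψ0(f(t)^{−1}) ) · f(t)^{d−1} · t^{−d} dt is finite, where f(t) = t·(log t)^{−β}. -/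
/-- The function `t⁻¹ (log t)^{-γ}` is integrable at infinity for `γ > 1`. -/
lemma integrableOn_Ioi_inv_mul_log_rpow {γ T : ℝ} (hγ : 1 < γ) (hT : 1 < T) :
    MeasureTheory.IntegrableOn (fun t : ℝ => t⁻¹ * Real.log t ^ (-γ)) (Set.Ioi T) := by
  have hlog : ∀ t ∈ Set.Ici T, 0 < Real.log t := fun t ht =>
    Real.log_pos (hT.trans_le ht)
  refine MeasureTheory.integrableOn_Ioi_deriv_of_nonneg'
    (g := fun t => Real.log t ^ (1 - γ) / (1 - γ)) (l := 0) ?_ ?_ ?_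
  · intro t ht
    have ht0 : t ≠ 0 := (zero_lt_one.trans (hT.trans_le ht)).ne'
    have h := ((Real.hasDerivAt_log ht0).rpow_const (p := 1 - γ)
      (Or.inl (hlog t ht).ne')).div_const (1 - γ)
    have hγ0 : (1 : ℝ) - γ ≠ 0 := by linarith
    rwa [show 1 - γ - 1 = -γ by ring, mul_right_comm, mul_div_cancel_right₀ _ hγ0] at h
  · intro t ht
    have ht' : T < t := ht
    have : 0 < t := by linarith
    have := hlog t ht'.le
    positivity
  · have h := ((tendsto_rpow_neg_atTop (y := γ - 1) (by linarith)).comp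
      Real.tendsto_log_atTop).div_const (1 - γ)
    simpa [Function.comp_def] using h

/-- Beyond some point the thorn profile `t (log t)^{-β}` is at least `1`, and `log t ≥ 1`. -/
lemma exists_forall_one_le_mul_log_rpow (β : ℝ) :
    ∃ T : ℝ, 1 < T ∧ ∀ t, T < t → 1 ≤ Real.log t ∧ 1 ≤ t * Real.log t ^ (-β) := by
  have h := (isLittleO_log_rpow_rpow_atTop β zero_lt_one).bound (c := 1) zero_lt_one
  have h1 := Real.tendsto_log_atTop.eventually_ge_atTop 1
  obtain ⟨T, hT⟩ := Filter.eventually_atTop.1 (h.and h1)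
  refine ⟨max T 2, by simp, fun t ht => ?_⟩
  have hTt : T < t := (le_max_left _ _).trans_lt ht
  have ht0 : 0 < t := by linarith [(le_max_right T 2).trans_lt ht]
  obtain ⟨hle, hl⟩ := hT t hTt.le
  have hl0 : 0 < Real.log t := by linarith
  refine ⟨hl, ?_⟩
  have hp : 0 < Real.log t ^ β := Real.rpow_pos_of_pos hl0 _
  rw [Real.rpow_one, one_mul, Real.norm_of_nonneg hp.le, Real.norm_of_nonneg ht0.le] at hle
  rw [Real.rpow_neg hl0.le, ← div_eq_mul_inv, le_div_iff₀ hp]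
  linarith


/-- Finiteness of the accessibility integral for the thorn
`f(t) = t·(log t)^{−β}` when `β·(d−1+2δ3) > 1`, under the lower weak scaling
condition at zero for `Ψ0` (hypothesis H2). -/
theorem thorn_integral_finite
    (d : ℕ) (hd : 1 ≤ d) (β δ3 a3 : ℝ) (hβ : 0 ≤ β)
    (hδ3 : 0 < δ3) (hδ3' : δ3 < 1) (ha3 : 0 < a3)
    (hβδ : 1 < β * ((d : ℝ) - 1 + 2 * δ3))
    (Ψ0 : ℝ → ℝ) (hΨ0meas : Measurable Ψ0) (hΨ0pos : ∀ t : ℝ, 0 < t → 0 < Ψ0 t)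
    (hscale : ∀ s t : ℝ, 0 < s → s ≤ t → t ≤ 1 → a3 * (t / s) ^ (2 * δ3) * Ψ0 s ≤ Ψ0 t) :
    ∃ T : ℝ, 1 < T ∧
      ∫⁻ t in Set.Ioi T,
          ENNReal.ofReal
            (Ψ0 t⁻¹ / Ψ0 (t * Real.log t ^ (-β))⁻¹ *
              (t * Real.log t ^ (-β)) ^ ((d : ℝ) - 1) * t ^ (-(d : ℝ))) < ⊤ := by
  obtain ⟨T, hT, hTf⟩ := exists_forall_one_le_mul_log_rpow β
  refine ⟨T, hT, ?_⟩
  have hint := (integrableOn_Ioi_inv_mul_log_rpow hβδ hT).const_mul a3⁻¹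
  refine lt_of_le_of_lt ?_ hint.lintegral_lt_top
  refine MeasureTheory.setLIntegral_mono' measurableSet_Ioi fun t ht =>
    ENNReal.ofReal_le_ofReal ?_
  obtain ⟨hl, hf⟩ := hTf t ht
  have ht0 : 0 < t := by linarith [Set.mem_Ioi.1 ht]
  have hl0 : 0 < Real.log t := by linarith
  set L := Real.log t
  have hfle : t * L ^ (-β) ≤ t :=
    mul_le_of_le_one_right ht0.le (Real.rpow_le_one_of_one_le_of_nonpos hl (by linarith))
  have hf0 : 0 < t * L ^ (-β) := by linarith
  have hs := hscale t⁻¹ (t * L ^ (-β))⁻¹ (inv_pos.2 ht0) (inv_anti₀ hf0 hfle)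
    (inv_le_one_of_one_le₀ hf)
  have hquot : (t * L ^ (-β))⁻¹ / t⁻¹ = L ^ β := by
    rw [Real.rpow_neg hl0.le]
    field_simp
  rw [hquot, ← Real.rpow_mul hl0.le] at hs
  have hΨ := hΨ0pos _ (inv_pos.2 hf0)
  have hratio : Ψ0 t⁻¹ / Ψ0 (t * L ^ (-β))⁻¹ ≤ a3⁻¹ * L ^ (-(β * (2 * δ3))) := by
    have hp : 0 < L ^ (β * (2 * δ3)) := Real.rpow_pos_of_pos hl0 _
    rw [Real.rpow_neg hl0.le (β * (2 * δ3)), ← mul_inv, div_le_iff₀ hΨ, inv_mul_eq_div,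
      le_div_iff₀ (by positivity)]
    linarith
  calc _ ≤ a3⁻¹ * L ^ (-(β * (2 * δ3))) * (t * L ^ (-β)) ^ ((d : ℝ) - 1) * t ^ (-(d : ℝ)) := by
        gcongr
    _ = a3⁻¹ * ((t ^ ((d : ℝ) - 1) * t ^ (-(d : ℝ))) *
          (L ^ (-(β * (2 * δ3))) * L ^ (-β * ((d : ℝ) - 1)))) := by
        rw [Real.mul_rpow ht0.le (by positivity), ← Real.rpow_mul hl0.le]
        ring
    _ = a3⁻¹ * (t⁻¹ * L ^ (-(β * ((d : ℝ) - 1 + 2 * δ3)))) := by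
        rw [← Real.rpow_add ht0, ← Real.rpow_add hl0, ← Real.rpow_neg_one t]
        ring_nf
end

section
/- Let α ∈ (0, 2] and define φ'(λ) = (α/2)·λ^{α/2 − 1}/(1 + λ^{α/2}) for λ > 0 (this is the derivative of the Laplace exponent φ(λ) = log(1 + λ^{α/2}) of the geometric (α/2)-stable subordinator). Then for all real λ ≥ 1 and t ≥ 1, φ'(λ·t) ≤ 2·t^{−1}·φ'(λ). Consequently φ satisfies hypothesis H with σ = 2, δ = 1 and λ0 = 1. -/
/-- For `s ≥ 0`, the function `x ↦ s·x^{s-1}/(1+x^s)` decays at least like `2·t⁻¹` under scaling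
by `t ≥ 1`, on `[1, ∞)`. -/
theorem mul_rpow_div_one_add_rpow_le {s x t : ℝ} (hs : 0 ≤ s) (hx : 1 ≤ x) (ht : 1 ≤ t) :
    s * (x * t) ^ (s - 1) / (1 + (x * t) ^ s) ≤ 2 * t⁻¹ * (s * x ^ (s - 1) / (1 + x ^ s)) := by
  have hx0 : 0 < x := by linarith
  have ht0 : 0 < t := by linarith
  have hxs : 1 ≤ x ^ s := Real.one_le_rpow hx hs
  have hts : 1 ≤ t ^ s := Real.one_le_rpow ht hs
  rw [Real.rpow_sub_one (mul_pos hx0 ht0).ne', Real.rpow_sub_one hx0.ne',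
    Real.mul_rpow hx0.le ht0.le]
  generalize x ^ s = a at *
  generalize t ^ s = b at *
  have key : b / (1 + a * b) ≤ 2 / (1 + a) := by
    rw [div_le_div_iff₀ (by positivity) (by positivity)]
    nlinarith
  calc s * (a * b / (x * t)) / (1 + a * b) = s * a / (x * t) * (b / (1 + a * b)) := by ring
    _ ≤ s * a / (x * t) * (2 / (1 + a)) := by gcongr
    _ = 2 * t⁻¹ * (s * (a / x) / (1 + a)) := by field_simp

/-- The derivative `φ'(λ) = (α/2)·λ^{α/2−1}/(1+λ^{α/2})` of the geometric
`(α/2)`-stable Laplace exponent satisfies `φ'(λt) ≤ 2·t⁻¹·φ'(λ)` for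
`λ, t ≥ 1`; consequently `φ` satisfies hypothesis H with `σ = 2`, `δ = 1`
and `λ0 = 1`. -/
theorem geometric_stable_H (α : ℝ) (hα : 0 < α) (hα2 : α ≤ 2) :
    (∀ lam t : ℝ, 1 ≤ lam → 1 ≤ t →
      α / 2 * (lam * t) ^ (α / 2 - 1) / (1 + (lam * t) ^ (α / 2)) ≤
        2 * t⁻¹ * (α / 2 * lam ^ (α / 2 - 1) / (1 + lam ^ (α / 2)))) ∧
    (∀ lam t : ℝ, 1 ≤ lam → 1 ≤ t →
      (α / 2 * (lam * t) ^ (α / 2 - 1) / (1 + (lam * t) ^ (α / 2))) /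
          (α / 2 * lam ^ (α / 2 - 1) / (1 + lam ^ (α / 2))) ≤ 2 * t ^ (-(1 : ℝ))) := by
  have hs : 0 < α / 2 := by linarith
  refine ⟨fun lam t hl ht => mul_rpow_div_one_add_rpow_le hs.le hl ht, fun lam t hl ht => ?_⟩
  have hl0 : 0 < lam := by linarith
  rw [div_le_iff₀ (by positivity), Real.rpow_neg_one]
  exact mul_rpow_div_one_add_rpow_le hs.le hl ht
end

section
/- Let d ≥ 1 be an integer, κ ∈ (0, 1/2] and r0 > 0 real numbers, and set r_n = (4/κ)^n · r0 for n ≥ 0. Let (A_n)_{n≥0} be points of ℝ^d such that for every n ≥ 0 the open ball B(A_n, κ·r_n) is contained in the complement of the closed ball B̄(0, r_n), and |A_n| < r_n/κ. Then the open balls B(A_n, κ·r_n), n ≥ 0, are pairwise disjoint. -/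
/-- Disjointness of the chain of balls constructed in the proof of
Proposition 4.2 of the paper: with `r_n = (4/κ)^n·r0`, the balls
`B(A_n, κ·r_n)` are pairwise disjoint whenever each is contained in the
complement of `B̄(0, r_n)` and `|A_n| < r_n/κ`. -/
theorem kappa_fat_balls_disjoint
    (d : ℕ) (hd : 1 ≤ d) (κ r0 : ℝ) (hκ0 : 0 < κ) (hκ : κ ≤ 1 / 2) (hr0 : 0 < r0)
    (A : ℕ → EuclideanSpace ℝ (Fin d))
    (hball : ∀ n : ℕ, Metric.ball (A n) (κ * ((4 / κ) ^ n * r0)) ⊆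
      (Metric.closedBall (0 : EuclideanSpace ℝ (Fin d)) ((4 / κ) ^ n * r0))ᶜ)
    (hA : ∀ n : ℕ, ‖A n‖ < (4 / κ) ^ n * r0 / κ) :
    Pairwise fun m n : ℕ =>
      Disjoint (Metric.ball (A m) (κ * ((4 / κ) ^ m * r0)))
        (Metric.ball (A n) (κ * ((4 / κ) ^ n * r0))) := by
  refine (pairwise_disjoint_on _).2 fun m n hmn => ?_
  refine (Set.disjoint_compl_right_iff_subset.2 fun x hx => ?_).mono_right (hball n)
  have hone : 1 ≤ 4 / κ := by
    rw [le_div_iff₀ hκ0]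
    linarith
  have hpow : (4 / κ) ^ (m + 1) * r0 ≤ (4 / κ) ^ n * r0 :=
    mul_le_mul_of_nonneg_right (pow_le_pow_right₀ hone hmn) hr0.le
  have hsum : (4 / κ) ^ m * r0 / κ + κ * ((4 / κ) ^ m * r0) ≤ (4 / κ) ^ (m + 1) * r0 := by
    have hcoef : 1 / κ + κ ≤ 4 / κ := by
      rw [div_add' _ _ _ hκ0.ne']
      gcongr
      nlinarith
    calc (4 / κ) ^ m * r0 / κ + κ * ((4 / κ) ^ m * r0)
        = (1 / κ + κ) * ((4 / κ) ^ m * r0) := by ring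
      _ ≤ 4 / κ * ((4 / κ) ^ m * r0) := by gcongr
      _ = (4 / κ) ^ (m + 1) * r0 := by ring
  rw [mem_ball_iff_norm] at hx
  rw [mem_closedBall_zero_iff]
  linarith [hA m, norm_le_norm_add_norm_sub' x (A m)]
end
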